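/- arXiv:2001.05051 — 2 statements merged into one kernel-verified Lean document; each statement's English description precedes it below -/
import Mathlib

section
/- Let H be a (finite simple) graph, let V_1, ..., V_n be pairwise disjoint subsets of V(H), and let k be a nonnegative integer. If for every subset S of {1, ..., n} the total domination number of H_S is at least 2|S| − 1 − 2k, then (V_1, ..., V_n) has a partial independent set of representatives of size at least n − k. -/
open SimpleGraph

/-- `f` picks, for each colour in `I`, a vertex of `W` of that colour, so that the chosen vertices
are independent in `G`. -/
def IsIndepTransversal {V ι : Type*} (G : SimpleGraph V) (c : V → ι) (I : Finset ι) (W : Set V)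
    (f : ι → V) : Prop :=
  ∀ i ∈ I, f i ∈ W ∧ c (f i) = i ∧ ∀ j ∈ I, ¬ G.Adj (f i) (f j)

/-- The vertices of `X` lie in `W`, have colours in `S`, and totally dominate the vertices of `W`
with colours in `S`. -/
structure TotallyDominates {V ι : Type*} (G : SimpleGraph V) (c : V → ι) (S : Finset ι)
    (W : Set V) (X : Finset V) : Prop where
  mem : ∀ z ∈ X, z ∈ W ∧ c z ∈ S
  dominates : ∀ u ∈ W, c u ∈ S → ∃ z ∈ X, G.Adj u z

theorem SimpleGraph.exists_critical_edge {V : Type*} [Finite V] (P : SimpleGraph V → Prop)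
    {G₀ G₁ : SimpleGraph V} (hle : G₀ ≤ G₁) (h₀ : ¬ P G₀) (h₁ : P G₁) :
    ∃ G : SimpleGraph V, ∃ u v : V, G ≤ G₁ ∧ P G ∧ G.Adj u v ∧ ¬ G₀.Adj u v ∧
      ¬ P (G.deleteEdges {s(u, v)}) := by
  have hfin : Finite (SimpleGraph V) :=
    Finite.of_injective (fun G : SimpleGraph V => G.Adj) fun _ _ h => SimpleGraph.ext h
  obtain ⟨G, ⟨hG₀, hG₁, hG⟩, hmin⟩ :=
    (Set.toFinite {G : SimpleGraph V | G₀ ≤ G ∧ G ≤ G₁ ∧ P G}).exists_minimal ⟨G₁, hle, le_rfl, h₁⟩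
  have hnot : ¬ G ≤ G₀ := fun h => h₀ (le_antisymm h hG₀ ▸ hG)
  have hedge : ∃ u v, G.Adj u v ∧ ¬ G₀.Adj u v := by
    by_contra! h
    exact hnot fun u v huv => h u v huv
  obtain ⟨u, v, huv, huv₀⟩ := hedge
  refine ⟨G, u, v, hG₁, hG, huv, huv₀, fun hP => ?_⟩
  have hle' : G ≤ G.deleteEdges {s(u, v)} := by
    refine hmin ⟨fun a b hab => ?_, (deleteEdges_le _).trans hG₁, hP⟩ (deleteEdges_le _)
    rw [deleteEdges_adj]
    refine ⟨hG₀ hab, fun h => huv₀ ?_⟩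
    rw [Set.mem_singleton_iff, Sym2.eq_iff] at h
    rcases h with ⟨rfl, rfl⟩ | ⟨rfl, rfl⟩
    exacts [hab, hab.symm]
  have := hle' huv
  simp [deleteEdges_adj] at this

/-- The endpoints of an edge whose deletion creates an independent transversal are both chosen. -/
theorem IsIndepTransversal.eq_of_deleteEdges {V ι : Type*} {G : SimpleGraph V} {c : V → ι}
    {I : Finset ι} {W : Set V} {f : ι → V} {x y : V}
    (hf : IsIndepTransversal (G.deleteEdges {s(x, y)}) c I W f)
    (hG : ∀ f, ¬ IsIndepTransversal G c I W f) :
    (c x ∈ I ∧ f (c x) = x) ∧ c y ∈ I ∧ f (c y) = y := by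
  have h : ∃ i ∈ I, ∃ j ∈ I, G.Adj (f i) (f j) := by
    by_contra! h
    exact hG f fun i hi => ⟨(hf i hi).1, (hf i hi).2.1, h i hi⟩
  obtain ⟨i, hi, j, hj, hij⟩ := h
  have hdel := (hf i hi).2.2 j hj
  rw [deleteEdges_adj, not_and_not_right] at hdel
  have heq := hdel hij
  rw [Set.mem_singleton_iff, Sym2.eq_iff] at heq
  have hci := (hf i hi).2.1
  have hcj := (hf j hj).2.1
  rcases heq with ⟨rfl, rfl⟩ | ⟨rfl, rfl⟩ <;> simp [hci, hcj, hi, hj]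

theorem exists_totallyDominates_of_critical_edge {V ι : Type*} [Finite V] (m : ℕ) :
    ∀ (G : SimpleGraph V) (c : V → ι) (I : Finset ι) (W : Set V) (x y : V) (f : ι → V),
      I.card = m → (∀ u v, G.Adj u v → c u ≠ c v) → G.Adj x y →
      (∀ g, ¬ IsIndepTransversal G c I W g) →
      IsIndepTransversal (G.deleteEdges {s(x, y)}) c I W f →
      ∃ (S : Finset ι) (X : Finset V), S ⊆ I ∧ c x ∈ S ∧ c y ∈ S ∧ X.card + 2 ≤ 2 * S.card ∧
        TotallyDominates G c S W X := by
  classical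
  induction m with
  | zero =>
    intro G c I W x y f hI _ _ hG _
    rw [Finset.card_eq_zero] at hI
    subst hI
    exact absurd (fun i hi => absurd hi (Finset.notMem_empty i)) (hG f)
  | succ m ih =>
    intro G c I W x y f hI hc hxy hG hf
    obtain ⟨⟨hxI, hfx⟩, hyI, hfy⟩ := hf.eq_of_deleteEdges hG
    have hab : c x ≠ c y := hc x y hxy
    have hxW : x ∈ W := hfx ▸ (hf _ hxI).1
    have hyW : y ∈ W := hfy ▸ (hf _ hyI).1
    by_cases hdom : ∀ w ∈ W, c w = c x ∨ c w = c y → G.Adj w x ∨ G.Adj w y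
    · refine ⟨{c x, c y}, {x, y}, ?_, by simp, by simp, ?_, ?_, ?_⟩
      · simp [Finset.insert_subset_iff, hxI, hyI]
      · rw [Finset.card_pair hab, Finset.card_pair hxy.ne]
      · rintro z hz
        rcases Finset.mem_insert.1 hz with rfl | hz
        · simp [hxW]
        · rw [Finset.mem_singleton] at hz
          subst hz
          simp [hyW]
      · intro u hu hcu
        rcases hdom u hu (by simpa using hcu) with h | h
        exacts [⟨x, by simp, h⟩, ⟨y, by simp, h⟩]
    push Not at hdom
    obtain ⟨w, hwW, hcw, hwx, hwy⟩ := hdom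
    -- Merge the two classes and discard the neighbours of `x` and `y`.
    let c' : V → ι := fun v => if c v = c y then c x else c v
    let W' : Set V := {v | v ∈ W ∧ ¬ G.Adj v x ∧ ¬ G.Adj v y}
    let G₁ : SimpleGraph V :=
      { Adj := fun u v => G.Adj u v ∧ c' u ≠ c' v
        symm := ⟨fun _ _ h => ⟨h.1.symm, h.2.symm⟩⟩
        loopless := ⟨fun _ h => h.2 rfl⟩ }
    let G₀ : SimpleGraph V :=
      { Adj := fun u v => G₁.Adj u v ∧ c' u ≠ c x ∧ c' v ≠ c x
        symm := ⟨fun _ _ h => ⟨h.1.symm, h.2.2, h.2.1⟩⟩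
        loopless := ⟨fun _ h => h.1.ne rfl⟩ }
    have hc'w : c' w = c x := by
      rcases hcw with h | h <;> simp [c', h]
    have hc'_of_ne : ∀ v i, i ≠ c x → c' v = i → c v = i := by
      intro v i hi hv
      by_cases h : c v = c y
      · simp only [c', h, if_true] at hv
        exact absurd hv.symm hi
      · simpa [c', h] using hv
    have hG₁ : ∀ g, ¬ IsIndepTransversal G₁ c' (I.erase (c y)) W' g := by
      intro g hg
      have hadj : ∀ i ∈ I, i ≠ c y → ∀ j ∈ I, j ≠ c y → ¬ G.Adj (g i) (g j) := by
        intro i hi hiy j hj hjy hij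
        have hi' := hg i (Finset.mem_erase.2 ⟨hiy, hi⟩)
        have hj' := hg j (Finset.mem_erase.2 ⟨hjy, hj⟩)
        refine hi'.2.2 j (Finset.mem_erase.2 ⟨hjy, hj⟩) ⟨hij, ?_⟩
        rw [hi'.2.1, hj'.2.1]
        rintro rfl
        exact hij.ne rfl
      have hgx := hg (c x) (Finset.mem_erase.2 ⟨hab, hxI⟩)
      have hW : ∀ i ∈ I, i ≠ c y → g i ∈ W ∧ ¬ G.Adj (g i) x ∧ ¬ G.Adj (g i) y :=
        fun i hi hiy => (hg i (Finset.mem_erase.2 ⟨hiy, hi⟩)).1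
      have hcol : ∀ i ∈ I, i ≠ c y → i ≠ c x → c (g i) = i := fun i hi hiy hix =>
        hc'_of_ne _ i hix (hg i (Finset.mem_erase.2 ⟨hiy, hi⟩)).2.1
      by_cases hcg : c (g (c x)) = c y
      · apply hG fun i => if i = c x then x else if i = c y then g (c x) else g i
        intro i hi
        have := hW (c x) hxI hab
        refine ⟨?_, ?_, fun j hj => ?_⟩
        · grind
        · grind
        · have h1 := hW i hi
          have h2 := hW j hj
          have h3 := hadj i hi
          have h4 := hadj (c x) hxI hab j hj
          grind [SimpleGraph.adj_comm, SimpleGraph.irrefl]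
      · have hcg' : c (g (c x)) = c x := by
          simpa [c', hcg] using hgx.2.1
        apply hG fun i => if i = c y then y else g i
        intro i hi
        refine ⟨?_, ?_, fun j hj => ?_⟩
        · grind
        · grind
        · have h1 := hW i hi
          have h2 := hW j hj
          have h3 := hadj i hi
          grind [SimpleGraph.adj_comm, SimpleGraph.irrefl]
    have hG₀ : IsIndepTransversal G₀ c' (I.erase (c y)) W' (fun i => if i = c x then w else f i) := by
      have hcol : ∀ i ∈ I, i ≠ c y → c' (f i) = i := by
        intro i hi hiy
        simp [c', (hf i hi).2.1, hiy]
      have hfadj : ∀ i ∈ I, ∀ j ∈ I, G.Adj (f i) (f j) → s(f i, f j) = s(x, y) := by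
        intro i hi j hj hij
        have := (hf i hi).2.2 j hj
        rw [deleteEdges_adj, not_and_not_right] at this
        exact this hij
      intro i hi
      obtain ⟨hiy, hi⟩ := Finset.mem_erase.1 hi
      by_cases hix : i = c x
      · subst hix
        refine ⟨by simpa using ⟨hwW, hwx, hwy⟩, by simpa using hc'w, fun j _ h => ?_⟩
        simp only [if_true] at h
        exact h.2.1 hc'w
      · have hfi : f i ≠ x ∧ f i ≠ y := by
          have := (hf i hi).2.1
          exact ⟨by rintro h; exact hix (by rw [← this, h]),
            by rintro h; exact hiy (by rw [← this, h])⟩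
        refine ⟨?_, ?_, fun j hj h => ?_⟩
        · simp only [hix, if_false]
          refine ⟨(hf i hi).1, fun h => ?_, fun h => ?_⟩
          · have := hfadj i hi (c x) hxI (by rwa [hfx])
            rw [Sym2.eq_iff] at this
            tauto
          · have := hfadj i hi (c y) hyI (by rwa [hfy])
            rw [Sym2.eq_iff] at this
            tauto
        · simpa [hix] using hcol i hi hiy
        · simp only [hix, if_false] at h
          by_cases hjx : j = c x
          · simp only [hjx, if_true] at h
            exact h.2.2 hc'w
          · simp only [hjx, if_false] at h
            have := hfadj i hi j (Finset.mem_of_mem_erase hj) h.1.1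
            rw [Sym2.eq_iff] at this
            tauto
    obtain ⟨G', u, v, hle, hG', huv, huv₀, hdel⟩ := exists_critical_edge
      (fun K => ∀ g, ¬ IsIndepTransversal K c' (I.erase (c y)) W' g)
      (G₀ := G₀) (G₁ := G₁) (fun _ _ h => h.1) (fun h => h _ hG₀) hG₁
    push Not at hdel
    obtain ⟨g, hg⟩ := hdel
    obtain ⟨S, X, hSI, huS, hvS, hcard, hX⟩ := ih G' c' (I.erase (c y)) W' u v g
      (by rw [Finset.card_erase_of_mem hyI, hI]; rfl) (fun _ _ h => (hle h).2) huv hG' hg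
    have hxS : c x ∈ S := by
      by_contra hxS
      exact huv₀ ⟨hle huv, fun h => hxS (h ▸ huS), fun h => hxS (h ▸ hvS)⟩
    have hyS : c y ∉ S := fun h => Finset.notMem_erase _ _ (hSI h)
    have hcS : ∀ z, c' z ∈ S ↔ c z ∈ insert (c y) S := by
      intro z
      by_cases h : c z = c y <;> simp [c', h, hxS]
    refine ⟨insert (c y) S, insert x (insert y X), ?_, by simp [hxS], by simp, ?_, ?_, ?_⟩
    · exact Finset.insert_subset hyI (hSI.trans (Finset.erase_subset _ _))
    · rw [Finset.card_insert_of_notMem hyS]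
      have h1 := Finset.card_insert_le x (insert y X)
      have h2 := Finset.card_insert_le y X
      omega
    · intro z hz
      rw [Finset.mem_insert, Finset.mem_insert] at hz
      rcases hz with rfl | rfl | hz
      · exact ⟨hxW, by simp [hxS]⟩
      · exact ⟨hyW, by simp⟩
      · exact ⟨(hX.mem z hz).1.1, (hcS z).1 (hX.mem z hz).2⟩
    · intro z hz hcz
      by_cases hzx : G.Adj z x
      · exact ⟨x, by simp, hzx⟩
      by_cases hzy : G.Adj z y
      · exact ⟨y, by simp, hzy⟩
      obtain ⟨t, ht, hzt⟩ := hX.dominates z ⟨hz, hzx, hzy⟩ ((hcS z).2 hcz)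
      exact ⟨t, by simp [ht], (hle hzt).1⟩

/-- **Haxell's theorem**: a vertex-coloured graph without an independent transversal has a set `S`
of colours whose classes are totally dominated by at most `2 * (|S| - 1)` of their vertices. -/
theorem exists_totallyDominates_of_no_indepTransversal {V ι : Type*} [Finite V]
    [Fintype ι] (G : SimpleGraph V) (c : V → ι) (W : Set V)
    (hc : ∀ u v, G.Adj u v → c u ≠ c v)
    (hG : ∀ g, ¬ IsIndepTransversal G c Finset.univ W g) :
    ∃ (S : Finset ι) (X : Finset V), X.card + 2 ≤ 2 * S.card ∧ TotallyDominates G c S W X := by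
  classical
  by_cases hne : ∀ i, ∃ v ∈ W, c v = i
  · choose g hg using hne
    have hbot : ¬ ∀ g, ¬ IsIndepTransversal (⊥ : SimpleGraph V) c Finset.univ W g :=
      fun h => h g fun i _ => ⟨(hg i).1, (hg i).2, fun _ _ h => h⟩
    obtain ⟨G', u, v, hle, hG', huv, -, hdel⟩ := exists_critical_edge
      (fun K => ∀ g, ¬ IsIndepTransversal K c Finset.univ W g) bot_le hbot hG
    push Not at hdel
    obtain ⟨g, hg⟩ := hdel
    obtain ⟨S, X, -, -, -, hcard, hX⟩ := exists_totallyDominates_of_critical_edge _ G' c Finset.univ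
      W u v g rfl (fun _ _ h => hc _ _ (hle h)) huv hG' hg
    refine ⟨S, X, hcard, hX.mem, fun z hz hcz => ?_⟩
    obtain ⟨t, ht, hzt⟩ := hX.dominates z hz hcz
    exact ⟨t, ht, hle hzt⟩
  · push Not at hne
    obtain ⟨i, hi⟩ := hne
    refine ⟨{i}, ∅, by simp, by simp, fun u hu hcu => ?_⟩
    exact absurd (Finset.mem_singleton.1 hcu) (hi u hu)

/-- The multipartite graph with classes indexed by `Fin n` whose edges are those of `H` together
with those of `k` disjoint complete graphs, each having one vertex in every class. -/
def padGraph {V : Type*} (H : SimpleGraph V) (n k : ℕ) : SimpleGraph (Fin n × (V ⊕ Fin k)) where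
  Adj p q := p.1 ≠ q.1 ∧
    ((∃ u v, p.2 = Sum.inl u ∧ q.2 = Sum.inl v ∧ H.Adj u v) ∨
      ∃ j, p.2 = Sum.inr j ∧ q.2 = Sum.inr j)
  symm := ⟨by
    rintro p q ⟨hne, ⟨u, v, hu, hv, h⟩ | ⟨j, hp, hq⟩⟩
    exacts [⟨hne.symm, Or.inl ⟨v, u, hv, hu, h.symm⟩⟩, ⟨hne.symm, Or.inr ⟨j, hq, hp⟩⟩]⟩
  loopless := ⟨fun _ h => h.1 rfl⟩

/-- The classes `Vs`, each padded with `k` additional vertices. -/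
def padVertices {V : Type*} {n : ℕ} (Vs : Fin n → Finset V) (k : ℕ) : Set (Fin n × (V ⊕ Fin k)) :=
  {p | ∀ v, p.2 = Sum.inl v → v ∈ Vs p.1}

theorem exists_partial_ISR_of_padGraph {V : Type*} [Fintype V] [DecidableEq V]
    {H : SimpleGraph V} {n k : ℕ} {Vs : Fin n → Finset V}
    (hdisj : ∀ i j, i ≠ j → Disjoint (Vs i) (Vs j)) {f : Fin n → Fin n × (V ⊕ Fin k)}
    (hf : IsIndepTransversal (padGraph H n k) Prod.fst Finset.univ (padVertices Vs k) f) :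
    ∃ (R : Finset V) (T : Finset (Fin n)),
      n - k ≤ T.card ∧
      (∀ u ∈ R, ∀ v ∈ R, ¬ H.Adj u v) ∧
      (∀ i ∈ T, (R ∩ Vs i).card = 1) ∧
      R ⊆ T.biUnion Vs := by
  classical
  have hfst : ∀ i, (f i).1 = i := fun i => (hf i (Finset.mem_univ i)).2.1
  have hadj : ∀ i j, ¬ (padGraph H n k).Adj (f i) (f j) := fun i j =>
    (hf i (Finset.mem_univ i)).2.2 j (Finset.mem_univ j)
  have hmem : ∀ i v, (f i).2 = Sum.inl v → v ∈ Vs i := fun i v h => by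
    simpa [hfst i] using (hf i (Finset.mem_univ i)).1 v h
  let T : Finset (Fin n) := {i | ∃ v, (f i).2 = Sum.inl v}
  have hTc : Tᶜ.card ≤ k := by
    have h : ∀ i ∈ Tᶜ, ∃ j, (f i).2 = Sum.inr j := by
      intro i hi
      cases hfi : (f i).2 with
      | inl v => simp [T, hfi] at hi
      | inr j => exact ⟨j, rfl⟩
    calc Tᶜ.card ≤ ((Finset.univ : Finset (Fin k)).image (Sum.inr : Fin k → V ⊕ Fin k)).card := by
          refine Finset.card_le_card_of_injOn (fun i => (f i).2) (fun i hi => ?_) ?_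
          · obtain ⟨j, hj⟩ := h i hi
            simp [hj]
          · intro i hi i' _ hii'
            by_contra hne
            obtain ⟨j, hj⟩ := h i hi
            exact hadj i i' ⟨by rwa [hfst, hfst], Or.inr ⟨j, hj, hii'.symm.trans hj⟩⟩
      _ ≤ k := Finset.card_image_le.trans (by simp)
  refine ⟨Finset.univ.filter fun v => ∃ i, (f i).2 = Sum.inl v, T, ?_, ?_, ?_, ?_⟩
  · have := Finset.card_add_card_compl T
    rw [Fintype.card_fin] at this
    omega
  · intro u hu v hv huv
    obtain ⟨i, hi⟩ := (Finset.mem_filter.1 hu).2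
    obtain ⟨j, hj⟩ := (Finset.mem_filter.1 hv).2
    refine hadj i j ⟨?_, Or.inl ⟨u, v, hi, hj, huv⟩⟩
    rw [hfst, hfst]
    rintro rfl
    rw [hi, Sum.inl.injEq] at hj
    exact huv.ne hj
  · intro i hi
    obtain ⟨v, hv⟩ := (Finset.mem_filter.1 hi).2
    rw [Finset.card_eq_one]
    refine ⟨v, Finset.ext fun w => ?_⟩
    simp only [Finset.mem_inter, Finset.mem_filter, Finset.mem_univ, true_and,
      Finset.mem_singleton]
    constructor
    · rintro ⟨⟨j, hj⟩, hw⟩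
      have : j = i := by
        by_contra hne
        exact Finset.disjoint_left.1 (hdisj j i hne) (hmem j w hj) hw
      subst this
      rw [hv, Sum.inl.injEq] at hj
      exact hj.symm
    · rintro rfl
      exact ⟨⟨i, hv⟩, hmem i w hv⟩
  · intro v hv
    obtain ⟨i, hi⟩ := (Finset.mem_filter.1 hv).2
    exact Finset.mem_biUnion.2 ⟨i, by simp [T, hi], hmem i v hi⟩

/-- A total dominating set of the padded graph uses at least two vertices of each added complete
graph; the rest of it totally dominates the original graph. -/
theorem exists_totalDominatingSet_of_padGraph {V : Type*} [DecidableEq V]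
    {H : SimpleGraph V} {n k : ℕ} {Vs : Fin n → Finset V}
    (hdisj : ∀ i j, i ≠ j → Disjoint (Vs i) (Vs j))
    {S : Finset (Fin n)} (hS : S.Nonempty) {Y : Finset (Fin n × (V ⊕ Fin k))}
    (hY : TotallyDominates (padGraph H n k) Prod.fst S (padVertices Vs k) Y) :
    ∃ X : Finset V, X.card + 2 * k ≤ Y.card ∧ X ⊆ S.biUnion Vs ∧
      ∀ u ∈ S.biUnion Vs, ∃ x ∈ X, H.Adj u x ∧ ¬ ∃ i ∈ S, u ∈ Vs i ∧ x ∈ Vs i := by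
  classical
  obtain ⟨i₀, hi₀⟩ := hS
  have hinr : ∀ i ∈ S, ∀ j, ∃ i', i ≠ i' ∧ i' ∈ S ∧ (i', Sum.inr j) ∈ Y := by
    intro i hi j
    obtain ⟨⟨i', z⟩, hzY, hne, h⟩ := hY.dominates (i, Sum.inr j) (by simp [padVertices]) hi
    rcases h with ⟨u, v, hu, -, -⟩ | ⟨j', hj, hz⟩
    · cases hu
    · cases hj
      cases hz
      exact ⟨i', hne, (hY.mem _ hzY).2, hzY⟩
  have hpair : ∀ j : Fin k, ∃ p q, p ≠ q ∧ (p, Sum.inr j) ∈ Y ∧ (q, Sum.inr j) ∈ Y := by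
    intro j
    obtain ⟨p, -, hp, hpY⟩ := hinr i₀ hi₀ j
    obtain ⟨q, hpq, -, hqY⟩ := hinr p hp j
    exact ⟨p, q, hpq, hpY, hqY⟩
  choose p q hpq hpY hqY using hpair
  let X : Finset V := Y.biUnion fun z => z.2.elim (fun v => {v}) fun _ => ∅
  have hX : ∀ v, v ∈ X ↔ ∃ i, (i, Sum.inl v) ∈ Y := by
    intro v
    simp only [X, Finset.mem_biUnion]
    constructor
    · rintro ⟨⟨i, z | z⟩, hz, hv⟩
      · simp only [Sum.elim_inl, Finset.mem_singleton] at hv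
        exact ⟨i, hv ▸ hz⟩
      · simp at hv
    · rintro ⟨i, hi⟩
      exact ⟨_, hi, by simp⟩
  refine ⟨X, ?_, ?_, ?_⟩
  · choose a ha using fun v : X => (hX v.1).1 v.2
    let φ : (X ⊕ Fin k) ⊕ Fin k → Y := Sum.elim
      (Sum.elim (fun v => ⟨(a v, Sum.inl v.1), ha v⟩) fun j => ⟨_, hpY j⟩) fun j => ⟨_, hqY j⟩
    have hφ : Function.Injective φ := by
      rintro ((⟨v, hv⟩ | j) | j) ((⟨v', hv'⟩ | j') | j') h <;> simp [φ] at h ⊢ <;> grind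
    have := Fintype.card_le_of_injective φ hφ
    simp only [Fintype.card_sum, Fintype.card_coe, Fintype.card_fin] at this
    omega
  · intro v hv
    obtain ⟨i, hi⟩ := (hX v).1 hv
    exact Finset.mem_biUnion.2 ⟨i, (hY.mem _ hi).2, (hY.mem _ hi).1 v rfl⟩
  · intro u hu
    obtain ⟨i, hi, hui⟩ := Finset.mem_biUnion.1 hu
    obtain ⟨⟨i', z⟩, hzY, hne, h⟩ := hY.dominates (i, Sum.inl u)
      (fun v hv => by cases hv; exact hui) hi
    rcases h with ⟨u', v, hu', hv, huv⟩ | ⟨j, hj, -⟩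
    · cases hu'
      cases hv
      refine ⟨v, (hX v).2 ⟨i', hzY⟩, huv, ?_⟩
      rintro ⟨l, -, hul, hvl⟩
      have hil : i = l := by
        by_contra h
        exact Finset.disjoint_left.1 (hdisj i l h) hui hul
      have hi'l : i' = l := by
        by_contra h
        exact Finset.disjoint_left.1 (hdisj i' l h) ((hY.mem _ hzY).1 v rfl) hvl
      exact hne (hil.trans hi'l.symm)
    · cases hj

theorem stmt_8 {V : Type} [Fintype V] [DecidableEq V]
    (H : SimpleGraph V)
    {n : ℕ} (Vs : Fin n → Finset V) (k : ℕ)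
    (hdisj : ∀ i j, i ≠ j → Disjoint (Vs i) (Vs j))
    -- for every `S ⊆ [n]`, every total dominating set `X` of `H_S` satisfies
    -- `|X| ≥ 2|S| - 1 - 2k`
    (htd : ∀ S : Finset (Fin n), ∀ X : Finset V,
      X ⊆ S.biUnion Vs →
      (∀ u ∈ S.biUnion Vs, ∃ x ∈ X,
        H.Adj u x ∧ ¬ ∃ i ∈ S, u ∈ Vs i ∧ x ∈ Vs i) →
      2 * S.card - 1 - 2 * k ≤ X.card) :
    -- there is a partial ISR of size at least `n - k`
    ∃ (R : Finset V) (T : Finset (Fin n)),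
      n - k ≤ T.card ∧
      (∀ u ∈ R, ∀ v ∈ R, ¬ H.Adj u v) ∧
      (∀ i ∈ T, (R ∩ Vs i).card = 1) ∧
      R ⊆ T.biUnion Vs := by
  by_contra hno
  obtain ⟨S, Y, hcard, hY⟩ := exists_totallyDominates_of_no_indepTransversal (padGraph H n k)
    Prod.fst (padVertices Vs k) (fun _ _ h => h.1)
    fun f hf => hno (exists_partial_ISR_of_padGraph hdisj hf)
  have hS : S.Nonempty := Finset.card_pos.1 (by omega)
  obtain ⟨X, hXY, hXS, hX⟩ := exists_totalDominatingSet_of_padGraph hdisj hS hY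
  have := htd S X hXS hX
  omega
end

section
/- Let G_1 and G_2 be (finite simple) graphs on the same vertex set V, where |V| is even and both G_1 and G_2 have maximum degree at most 2. Then there is a partition of V into two sets W_1 and W_2 with |W_1| = |W_2| such that the induced subgraph G_1[W_1] has maximum degree at most 1 and the induced subgraph G_2[W_2] has maximum degree at most 1. -/
open SimpleGraph

/-- A set `Z` of explored vertices together with an involution `M` of the explored vertices outside
the dead set `D`, such that two neighbours of an explored vertex `v` and `v` itself always contain
a vertex of `Y` or a pair `{v, M v}`. -/
structure PairingInvariant {V : Type} (G : SimpleGraph V) (D Y Z : Finset V) (M : V → V) :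
    Prop where
  dead_subset : D ⊆ Z
  invol : ∀ v, M (M v) = v
  support : ∀ v, M v ≠ v → v ∈ Z ∧ v ∉ D
  window : ∀ v ∈ Z, ∀ p q, G.Adj v p → G.Adj v q → p ≠ q →
    v ∈ Y ∨ p ∈ Y ∨ q ∈ Y ∨ M v = p ∨ M v = q

/-- `Z` is a union of connected components of `G`. -/
def AdjClosed {V : Type} (G : SimpleGraph V) (Z : Finset V) : Prop :=
  ∀ v ∈ Z, ∀ p, G.Adj v p → p ∈ Z

/-- Any three neighbours of a vertex contain a repetition. -/
def AtMostTwoNeighbors {V : Type} (G : SimpleGraph V) : Prop :=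
  ∀ v a b c, G.Adj v a → G.Adj v b → G.Adj v c → a = b ∨ a = c ∨ b = c

theorem atMostTwoNeighbors_of_degree_le {V : Type} [Fintype V] [DecidableEq V]
    (G : SimpleGraph V) [DecidableRel G.Adj] (h : ∀ v, G.degree v ≤ 2) :
    AtMostTwoNeighbors G := by
  intro v a b c ha hb hc
  by_contra! hne
  obtain ⟨hab, hac, hbc⟩ := hne
  have hsub : ({a, b, c} : Finset V) ⊆ G.neighborFinset v := by
    intro w hw
    simp only [Finset.mem_insert, Finset.mem_singleton] at hw
    rcases hw with rfl | rfl | rfl <;> simpa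
  have h3 : ({a, b, c} : Finset V).card = 3 := Finset.card_eq_three.2 ⟨a, b, c, hab, hac, hbc, rfl⟩
  have := Finset.card_le_card hsub
  have := h v
  rw [← G.card_neighborFinset_eq_degree] at this
  omega

/-- Explored vertices whose exploration front is contained in `{y, e}`, with `y` in `Y`, can be
enlarged to a union of connected components. -/
theorem PairingInvariant.exists_adjClosed {V : Type} [Fintype V] [DecidableEq V]
    {G : SimpleGraph V} (hG : AtMostTwoNeighbors G) {D Y : Finset V} {y : V} (hy : y ∈ Y)
    (n : ℕ) : ∀ (Z : Finset V) (M : V → V) (e : V), Zᶜ.card ≤ n → PairingInvariant G D Y Z M →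
      y ∈ Z → e ∈ Z → (e ≠ y → ∃ d ∈ Z, G.Adj e d) →
      (∀ v ∈ Z, ∀ p, p ∉ Z → G.Adj v p → v = y ∨ v = e) →
      ∃ Z' M', AdjClosed G Z' ∧ PairingInvariant G D Y Z' M' := by
  induction n with
  | zero =>
    intro Z M e hn hI _ _ _ _
    have : Z = Finset.univ := by
      rw [← Finset.compl_eq_empty_iff, ← Finset.card_eq_zero]; omega
    exact ⟨Z, M, fun v _ p _ => by simp [this], hI⟩
  | succ n ih =>
    intro Z M e hn hI hyZ heZ hd hfr
    have hfix : ∀ v, v ∉ Z → M v = v := fun v hv => by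
      by_contra h; exact hv (hI.support v h).1
    have hcard : ∀ (p : V) (Z' : Finset V), p ∉ Z → insert p Z ⊆ Z' → Z'ᶜ.card ≤ n := by
      intro p Z' hp hs
      have h1 : Z'.card ≥ Z.card + 1 := by
        rw [← Finset.card_insert_of_notMem hp]; exact Finset.card_le_card hs
      have := Finset.card_add_card_compl Z
      have := Finset.card_add_card_compl Z'
      omega
    by_cases hA : ∃ p, p ∉ Z ∧ G.Adj e p ∧ e ≠ y
    · obtain ⟨p, hp, hep, hey⟩ := hA
      obtain ⟨d, hdZ, hed⟩ := hd hey
      have hfr' : ∀ v ∈ Z, ∀ w, w ∉ Z → w ≠ p → G.Adj v w → v = y := by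
        intro v hv w hw hwp hvw
        rcases hfr v hv w hw hvw with h | rfl
        · exact h
        · rcases hG v d p w hed hep hvw with h | h | h
          · exact absurd (h ▸ hdZ) hp
          · exact absurd (h ▸ hdZ) hw
          · exact absurd h.symm hwp
      by_cases hr : ∃ r, r ∉ Z ∧ G.Adj p r
      · obtain ⟨r, hr, hpr⟩ := hr
        have hne : p ≠ r := hpr.ne
        refine ih (insert p (insert r Z)) (fun v => if v = p then r else if v = r then p else M v) r
          (hcard p _ hp (by grind)) ⟨?_, ?_, ?_, ?_⟩ (by grind) (by grind)
          (fun _ => ⟨p, by simp, hpr.symm⟩) ?_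
        · have := hI.dead_subset
          grind
        · intro v
          have := hI.invol v
          have := hfix p hp
          have := hfix r hr
          grind
        · intro v hv
          have := hI.support v
          have := hI.dead_subset
          grind
        · intro v hv q₁ q₂ h₁ h₂ h12
          have := hI.window v
          have := hG v q₁ q₂ r h₁ h₂
          have := hG v q₁ q₂ p h₁ h₂
          have := hpr.symm
          clear ih hfr hfr' hcard hd
          grind
        · intro v hv w hw hvw
          have := hfr' v
          have := hG p e r w
          have := hep.symm
          grind
      · refine ih (insert p Z) M y (hcard p _ hp subset_rfl) ⟨?_, hI.invol, ?_, ?_⟩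
          (by grind) (by grind) (fun h => absurd rfl h) ?_
        · exact hI.dead_subset.trans (Finset.subset_insert _ _)
        · exact fun v hv => ⟨Finset.mem_insert_of_mem (hI.support v hv).1, (hI.support v hv).2⟩
        · intro v hv q₁ q₂ h₁ h₂ h12
          rcases Finset.mem_insert.1 hv with rfl | hv
          · have h1 : q₁ ∈ Z := by grind
            have h2 : q₂ ∈ Z := by grind
            have := hfr q₁ h1 v hp h₁.symm
            have := hfr q₂ h2 v hp h₂.symm
            grind
          · exact hI.window v hv q₁ q₂ h₁ h₂ h12
        · intro v hv w hw hvw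
          have := hfr' v
          grind
    · by_cases hB : ∃ p, p ∉ Z ∧ G.Adj y p
      · obtain ⟨p, hp, hyp⟩ := hB
        refine ih (insert p Z) M p (hcard p _ hp subset_rfl) ⟨?_, hI.invol, ?_, ?_⟩
          (by grind) (by grind) (fun _ => ⟨y, by grind, hyp.symm⟩) ?_
        · exact hI.dead_subset.trans (Finset.subset_insert _ _)
        · exact fun v hv => ⟨Finset.mem_insert_of_mem (hI.support v hv).1, (hI.support v hv).2⟩
        · intro v hv q₁ q₂ h₁ h₂ h12
          rcases Finset.mem_insert.1 hv with rfl | hv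
          · have := hG v q₁ q₂ y h₁ h₂ hyp.symm
            grind
          · exact hI.window v hv q₁ q₂ h₁ h₂ h12
        · intro v hv w hw hvw
          have := hfr v
          grind
      · refine ⟨Z, M, fun v hv p hvp => ?_, hI⟩
        by_contra hp
        have := hfr v hv p hp hvp
        grind

/-- The paired vertices are split evenly into queried ones `Q` and responses `Y`, and the pairing
can be continued so that the responses meet all paths on three vertices. -/
def OnlinePairing {V : Type} [DecidableEq V] (G : SimpleGraph V) (Q Y : Finset V) : Prop :=
  ∃ Z M, AdjClosed G Z ∧ PairingInvariant G (Q ∪ Y) Y Z M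

theorem OnlinePairing.empty {V : Type} [DecidableEq V] (G : SimpleGraph V) :
    OnlinePairing G ∅ ∅ :=
  ⟨∅, id, by simp [AdjClosed], by simp, by simp, by simp, by simp⟩

theorem OnlinePairing.exists_mem {V : Type} [Fintype V] [DecidableEq V] {G : SimpleGraph V}
    {Q Y : Finset V} (h : OnlinePairing G Q Y) (huniv : Q ∪ Y = Finset.univ) {v p q : V}
    (hp : G.Adj v p) (hq : G.Adj v q) (hpq : p ≠ q) : v ∈ Y ∨ p ∈ Y ∨ q ∈ Y := by
  obtain ⟨Z, M, -, hI⟩ := h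
  have hM : M v = v := by
    by_contra h
    exact (hI.support v h).2 (by simp [huniv])
  have := hI.window v (hI.dead_subset (by simp [huniv])) p q hp hq hpq
  rw [hM] at this
  have := hp.ne
  have := hq.ne
  tauto

/-- Responding to an explored query with a vertex `y`, which must be its partner if there is one. -/
theorem PairingInvariant.respond {V : Type} [DecidableEq V] {G : SimpleGraph V}
    {Q Y Z : Finset V} {M : V → V} (hI : PairingInvariant G (Q ∪ Y) Y Z M) {x y : V}
    (hx : x ∈ Z) (hy : y ∈ Z) (hxy : M x = x ∨ M x = y) :
    PairingInvariant G (insert x Q ∪ insert y Y) (insert y Y) Z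
      (fun v => if v = y ∨ M v = y then v else M v) := by
  have hinv := hI.invol
  refine ⟨?_, ?_, ?_, ?_⟩
  · have := hI.dead_subset
    grind
  · intro v
    have := hinv v
    have := hinv y
    grind
  · intro v hv
    have := hI.support v
    have := hinv v
    have := hinv x
    have := hinv y
    grind
  · intro v hv p q hp hq hpq
    have := hI.window v hv p q hp hq hpq
    grind

theorem OnlinePairing.exists_response_of_mem {V : Type} [Fintype V] [DecidableEq V]
    {G : SimpleGraph V} (hG : AtMostTwoNeighbors G) {Q Y Z : Finset V} {M : V → V}
    (hZ : AdjClosed G Z) (hI : PairingInvariant G (Q ∪ Y) Y Z M) {x t : V}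
    (hxZ : x ∈ Z) (ht : t ∉ Q ∪ Y) (htx : t ≠ x) :
    ∃ y, y ∉ Q ∪ Y ∧ y ≠ x ∧ OnlinePairing G (insert x Q) (insert y Y) := by
  by_cases hM : M x = x
  · refine ⟨t, ht, htx, ?_⟩
    by_cases htZ : t ∈ Z
    · exact ⟨Z, _, hZ, hI.respond hxZ htZ (Or.inl hM)⟩
    · refine PairingInvariant.exists_adjClosed hG (Finset.mem_insert_self t Y) _ (insert t Z) M t
        le_rfl ⟨?_, hI.invol, ?_, ?_⟩ (by simp) (by simp) (fun h => absurd rfl h) ?_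
      · have := hI.dead_subset
        grind
      · intro v hv
        have := hI.support v hv
        grind
      · intro v hv p q hp hq hpq
        have := hI.window v
        grind
      · intro v hv p hp hvp
        have := hZ v
        grind
  · refine ⟨M x, fun h => ?_, hM, Z, _, hZ, hI.respond hxZ ?_ (Or.inr rfl)⟩
    · exact (hI.support (M x) (by rw [hI.invol]; exact Ne.symm hM)).2 h
    · exact (hI.support (M x) (by rw [hI.invol]; exact Ne.symm hM)).1

theorem OnlinePairing.exists_response {V : Type} [Fintype V] [DecidableEq V]
    {G : SimpleGraph V} (hG : AtMostTwoNeighbors G) {Q Y : Finset V} (h : OnlinePairing G Q Y)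
    {x t : V} (ht : t ∉ Q ∪ Y) (htx : t ≠ x) :
    ∃ y, y ∉ Q ∪ Y ∧ y ≠ x ∧ OnlinePairing G (insert x Q) (insert y Y) := by
  obtain ⟨Z, M, hZ, hI⟩ := h
  by_cases hxZ : x ∈ Z
  · exact exists_response_of_mem hG hZ hI hxZ ht htx
  by_cases hnb : ∃ y, G.Adj x y
  · obtain ⟨y, hxy⟩ := hnb
    have hyZ : y ∉ Z := fun h => hxZ (hZ y h x hxy.symm)
    refine ⟨y, fun h => hyZ (hI.dead_subset h), hxy.ne', ?_⟩
    refine PairingInvariant.exists_adjClosed hG (Finset.mem_insert_self y Y) _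
      (insert x (insert y Z)) M x le_rfl ⟨?_, hI.invol, ?_, ?_⟩ (by simp) (by simp)
      (fun _ => ⟨y, by simp, hxy⟩) ?_
    · have := hI.dead_subset
      grind
    · intro v hv
      have := hI.support v hv
      grind
    · intro v hv p q hp hq hpq
      have := hI.window v
      have := hG x p q y
      grind
    · intro v hv p hp hvp
      have := hZ v
      grind
  · refine exists_response_of_mem (Z := insert x Z) (M := M) hG ?_ ⟨?_, hI.invol, ?_, ?_⟩
      (by simp) ht htx
    · intro v hv p hvp
      have := hZ v
      grind
    · have := hI.dead_subset
      grind
    · intro v hv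
      have := hI.support v hv
      grind
    · intro v hv p q hp hq hpq
      have := hI.window v
      grind

theorem exists_ne_notMem_of_even {V : Type} [Fintype V] [DecidableEq V]
    (heven : Even (Fintype.card V)) {R B : Finset V} (hd : Disjoint R B) (hc : R.card = B.card)
    {z : V} (hz : z ∉ R ∪ B) : ∃ t, t ∉ R ∪ B ∧ t ≠ z := by
  by_contra! h
  have huniv : insert z (R ∪ B) = Finset.univ := by
    ext t
    have := h t
    simp only [Finset.mem_univ, iff_true, Finset.mem_insert]
    tauto
  have hcard := Finset.card_insert_of_notMem hz
  rw [huniv, Finset.card_union_of_disjoint hd, Finset.card_univ] at hcard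
  obtain ⟨k, hk⟩ := heven
  omega

/-- An alternating walk of queries and responses in `G₁` and `G₂`, from `s` to the response `y`
that has not yet been queried in `G₂`, can be continued until it closes up. -/
theorem OnlinePairing.exists_closed_of_open {V : Type} [Fintype V] [DecidableEq V]
    {G₁ G₂ : SimpleGraph V} (hG₁ : AtMostTwoNeighbors G₁) (hG₂ : AtMostTwoNeighbors G₂)
    (heven : Even (Fintype.card V)) {s : V} (n : ℕ) : ∀ (R B : Finset V) (y : V),
      (R ∪ B)ᶜ.card ≤ n → Disjoint R B → R.card = B.card → s ∈ R → y ∈ B →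
      OnlinePairing G₁ R B → OnlinePairing G₂ (B.erase y) (R.erase s) →
      ∃ R' B', R ∪ B ⊆ R' ∪ B' ∧ Disjoint R' B' ∧ R'.card = B'.card ∧
        OnlinePairing G₁ R' B' ∧ OnlinePairing G₂ B' R' := by
  induction n with
  | zero =>
    intro R B y hn hd hc hs hy h₁ h₂
    have huniv : ∀ v, v ∈ R ∪ B := by
      rw [← Finset.eq_univ_iff_forall, ← Finset.compl_eq_empty_iff, ← Finset.card_eq_zero]
      omega
    rw [Finset.disjoint_left] at hd
    obtain ⟨z, hz, hzy, h⟩ := h₂.exists_response hG₂ (x := y) (t := s) (by grind) (by grind)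
    have := huniv z
    obtain rfl : z = s := by grind
    rw [Finset.insert_erase hs, Finset.insert_erase hy] at h
    exact ⟨R, B, subset_rfl, Finset.disjoint_left.2 hd, hc, h₁, h⟩
  | succ n ih =>
    intro R B y hn hd hc hs hy h₁ h₂
    have hd' := Finset.disjoint_left.1 hd
    obtain ⟨z, hz, hzy, h⟩ := h₂.exists_response hG₂ (x := y) (t := s) (by grind) (by grind)
    rw [Finset.insert_erase hy] at h
    by_cases hzs : z = s
    · rw [hzs, Finset.insert_erase hs] at h
      exact ⟨R, B, subset_rfl, hd, hc, h₁, h⟩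
    have hzRB : z ∉ R ∪ B := by grind
    obtain ⟨t, ht, htz⟩ := exists_ne_notMem_of_even heven hd hc hzRB
    obtain ⟨w, hw, hwz, h'⟩ := h₁.exists_response hG₁ ht htz
    have hzR : z ∉ R := by grind
    have hwB : w ∉ B := by grind
    have hlt : (insert z R ∪ insert w B)ᶜ.card < (R ∪ B)ᶜ.card := by
      refine Finset.card_lt_card (Finset.compl_ssubset_compl.2 ?_)
      exact Finset.ssubset_iff_of_subset (by grind) |>.2 ⟨z, by grind, hzRB⟩
    obtain ⟨R', B', hsub, hR⟩ := ih (insert z R) (insert w B) w (by omega)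
      (Finset.disjoint_left.2 (by grind))
      (by rw [Finset.card_insert_of_notMem hzR, Finset.card_insert_of_notMem hwB, hc])
      (by grind) (by grind) h'
      (by rwa [Finset.erase_insert hwB, Finset.erase_insert_of_ne hzs])
    exact ⟨R', B', subset_trans (by grind) hsub, hR⟩

theorem OnlinePairing.exists_univ {V : Type} [Fintype V] [DecidableEq V]
    {G₁ G₂ : SimpleGraph V} (hG₁ : AtMostTwoNeighbors G₁) (hG₂ : AtMostTwoNeighbors G₂)
    (heven : Even (Fintype.card V)) (n : ℕ) : ∀ R B : Finset V,
      (R ∪ B)ᶜ.card ≤ n → Disjoint R B → R.card = B.card →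
      OnlinePairing G₁ R B → OnlinePairing G₂ B R →
      ∃ R' B', R' ∪ B' = Finset.univ ∧ Disjoint R' B' ∧ R'.card = B'.card ∧
        OnlinePairing G₁ R' B' ∧ OnlinePairing G₂ B' R' := by
  induction n with
  | zero =>
    intro R B hn hd hc h₁ h₂
    refine ⟨R, B, ?_, hd, hc, h₁, h₂⟩
    rw [← Finset.compl_eq_empty_iff, ← Finset.card_eq_zero]
    omega
  | succ n ih =>
    intro R B hn hd hc h₁ h₂
    by_cases huniv : R ∪ B = Finset.univ
    · exact ⟨R, B, huniv, hd, hc, h₁, h₂⟩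
    obtain ⟨s, hs⟩ : ∃ s, s ∉ R ∪ B := by
      simpa [Finset.eq_univ_iff_forall] using huniv
    have hd' := Finset.disjoint_left.1 hd
    obtain ⟨t, ht, hts⟩ := exists_ne_notMem_of_even heven hd hc hs
    obtain ⟨y, hy, hys, h⟩ := h₁.exists_response hG₁ ht hts
    have hsR : s ∉ R := by grind
    have hyB : y ∉ B := by grind
    obtain ⟨R', B', hsub, hd', hc', h₁', h₂'⟩ := exists_closed_of_open hG₁ hG₂ heven (s := s) _
      (insert s R) (insert y B) y le_rfl (Finset.disjoint_left.2 (by grind))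
      (by rw [Finset.card_insert_of_notMem hsR, Finset.card_insert_of_notMem hyB, hc])
      (by grind) (by grind) h
      (by rwa [Finset.erase_insert hyB, Finset.erase_insert hsR])
    refine ih R' B' ?_ hd' hc' h₁' h₂'
    have hlt : (R' ∪ B')ᶜ.card < (R ∪ B)ᶜ.card := by
      refine Finset.card_lt_card (Finset.compl_ssubset_compl.2 ?_)
      exact Finset.ssubset_iff_of_subset (subset_trans (by grind) hsub) |>.2 ⟨s, by grind, hs⟩
    omega

theorem OnlinePairing.card_neighborFinset_inter_le_one {V : Type} [Fintype V] [DecidableEq V]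
    {G : SimpleGraph V} [DecidableRel G.Adj] {Q Y : Finset V} (h : OnlinePairing G Q Y)
    (huniv : Q ∪ Y = Finset.univ) (hd : Disjoint Q Y) {v : V} (hv : v ∈ Q) :
    (G.neighborFinset v ∩ Q).card ≤ 1 := by
  rw [Finset.card_le_one]
  intro p hp q hq
  rw [Finset.mem_inter, mem_neighborFinset] at hp hq
  rw [Finset.disjoint_left] at hd
  by_contra hpq
  rcases h.exists_mem huniv hp.1 hq.1 hpq with h | h | h
  · exact hd hv h
  · exact hd hp.2 h
  · exact hd hq.2 h

theorem stmt_12 {V : Type} [Fintype V] [DecidableEq V]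
    (G₁ G₂ : SimpleGraph V) [DecidableRel G₁.Adj] [DecidableRel G₂.Adj]
    (heven : Even (Fintype.card V))
    (h1 : ∀ v, G₁.degree v ≤ 2)
    (h2 : ∀ v, G₂.degree v ≤ 2) :
    ∃ W₁ W₂ : Finset V,
      Disjoint W₁ W₂ ∧ W₁ ∪ W₂ = Finset.univ ∧ W₁.card = W₂.card ∧
      (∀ v ∈ W₁, (G₁.neighborFinset v ∩ W₁).card ≤ 1) ∧
      (∀ v ∈ W₂, (G₂.neighborFinset v ∩ W₂).card ≤ 1) := by
  obtain ⟨R, B, huniv, hd, hc, hR, hB⟩ := OnlinePairing.exists_univ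
    (atMostTwoNeighbors_of_degree_le G₁ h1) (atMostTwoNeighbors_of_degree_le G₂ h2) heven _ ∅ ∅
    le_rfl (Finset.disjoint_empty_left _) rfl (OnlinePairing.empty G₁) (OnlinePairing.empty G₂)
  exact ⟨R, B, hd, huniv, hc, fun v hv => hR.card_neighborFinset_inter_le_one huniv hd hv,
    fun v hv => hB.card_neighborFinset_inter_le_one (by rwa [Finset.union_comm]) hd.symm hv⟩
end
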